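/- arXiv:1805.05025 — 2 statements merged into one kernel-verified Lean document; each statement's English description precedes it below -/
import Mathlib

section
/- Let τ_{1/3} := min{t ≥ 0 : σ_t ∈ S_non(1/3)} be the first time the product replacement chain hits S_non(1/3). Then for all large enough n and for all large enough β > 0, max_{σ∈S} Pr_σ(τ_{1/3} > n·log n + β·n) ≤ 120·Q/β². -/
open scoped BigOperators
open Filter

attribute [local instance] Classical.propDecidable

noncomputable section

namespace PR

variable (G : Type) [Group G] [Fintype G]

/-- A configuration: an `n`-tuple of elements of `G`. -/
abbrev Config (n : ℕ) := Fin n → G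

/-- The set of generating `n`-tuples. -/
def gens (n : ℕ) : Set (Config G n) :=
  {σ | Subgroup.closure (Set.range σ) = ⊤}

/-- A move of the product replacement chain: an ordered pair of distinct indices
together with a sign (`true` = multiply, `false` = multiply by inverse). -/
abbrev Move (n : ℕ) := {p : Fin n × Fin n // p.1 ≠ p.2} × Bool

/-- Applying a move: replace `σ i` by `σ i * (σ j)^{±1}`. -/
def applyMove {n : ℕ} (σ : Config G n) (m : Move n) : Config G n :=
  Function.update σ m.1.1.1
    (σ m.1.1.1 * (if m.2 then σ m.1.1.2 else (σ m.1.1.2)⁻¹))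

/-- One-step transition probability of the product replacement chain. -/
def step {n : ℕ} (σ σ' : Config G n) : ℝ :=
  ((Finset.univ.filter (fun m : Move n => applyMove G σ m = σ')).card : ℝ) /
    (Fintype.card (Move n) : ℝ)

/-- The law of `σ_t` for the chain started at `σ₀`. -/
def law {n : ℕ} (σ₀ : Config G n) : ℕ → Config G n → ℝ
  | 0 => fun σ' => if σ' = σ₀ then 1 else 0
  | (t + 1) => fun σ' => ∑ τ : Config G n, law σ₀ t τ * step G τ σ'

/-- Probability that `σ_t ∈ E` for the chain started at `σ₀`. -/
def prob {n : ℕ} (σ₀ : Config G n) (t : ℕ) (E : Set (Config G n)) : ℝ :=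
  ∑ τ ∈ Finset.univ.filter (fun τ => τ ∈ E), law G σ₀ t τ

/-- Probability of a trajectory event for the chain started at `σ₀`, over the
time horizon `{0, 1, …, T}`. -/
def pathProb {n : ℕ} (σ₀ : Config G n) (T : ℕ)
    (E : Set (Fin (T + 1) → Config G n)) : ℝ :=
  ∑ p ∈ Finset.univ.filter
      (fun p : Fin (T + 1) → Config G n => p 0 = σ₀ ∧ p ∈ E),
    ∏ t : Fin T, step G (p t.castSucc) (p t.succ)

/-- `n_a(σ)`: the number of sites holding the group element `a`. -/
def nCount {n : ℕ} (σ : Config G n) (a : G) : ℕ :=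
  (Finset.univ.filter (fun i => σ i = a)).card

/-- `n^H_non(σ)`: the number of sites whose element lies outside `H`. -/
def nNon {n : ℕ} (H : Subgroup G) (σ : Config G n) : ℕ :=
  (Finset.univ.filter (fun i => σ i ∉ H)).card

/-- `n^{id}_non(σ)`: the number of sites not holding the identity. -/
def nNonId {n : ℕ} (σ : Config G n) : ℕ :=
  (Finset.univ.filter (fun i => σ i ≠ 1)).card

/-- `S_non(c)`. -/
def SNon (n : ℕ) (c : ℝ) : Set (Config G n) :=
  {σ | σ ∈ gens G n ∧
    ∀ H : Subgroup G, H ≠ ⊤ → c * n ≤ (nNon G H σ : ℝ)}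

/-- The `δ`-typical set `S_*(δ)`. -/
def SAst (n : ℕ) (δ : ℝ) : Set (Config G n) :=
  {σ | σ ∈ gens G n ∧
    Real.sqrt (∑ a : G, ((nCount G σ a : ℝ) / n - 1 / (Fintype.card G : ℝ)) ^ 2) ≤ δ}

/-- `n^{σ₀}_{a,b}(σ)`. -/
def nab {n : ℕ} (σ₀ σ : Config G n) (a b : G) : ℕ :=
  (Finset.univ.filter (fun i => σ₀ i = a ∧ σ i = b)).card

/-- `S_*(σ₀, r)`. -/
def SAstM {n : ℕ} (σ₀ : Config G n) (r : ℝ) : Set (Config G n) :=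
  {σ | σ ∈ gens G n ∧
    ∀ a : G, Real.sqrt (∑ b : G,
      ((nab G σ₀ σ a b : ℝ) / (nCount G σ₀ a : ℝ) - 1 / (Fintype.card G : ℝ)) ^ 2) ≤ r}

/-- The uniform stationary distribution `π` on the set of generating tuples. -/
def statDist (n : ℕ) : Config G n → ℝ := fun σ =>
  if σ ∈ gens G n then
    1 / ((Finset.univ.filter (fun τ : Config G n => τ ∈ gens G n)).card : ℝ)
  else 0

/-- Total-variation distance between two (finitely supported) signed weights,
as the supremum over finite sets `A` of `|p(A) - q(A)|`. -/
def tvDist {α : Type*} (p q : α → ℝ) : ℝ :=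
  sSup {x : ℝ | ∃ A : Finset α, x = |∑ a ∈ A, p a - ∑ a ∈ A, q a|}

/-- `d_σ(t) = max_{A ⊆ S} |P_σ(σ_t ∈ A) - π(A)|`. -/
def dTV {n : ℕ} (σ : Config G n) (t : ℕ) : ℝ :=
  sSup {x : ℝ | ∃ A : Finset (Config G n), ↑A ⊆ gens G n ∧
    x = |∑ τ ∈ A, law G σ t τ - ∑ τ ∈ A, statDist G n τ|}

/-- `max_{σ ∈ S} d_σ(t)`. -/
def dMax (n : ℕ) (t : ℕ) : ℝ :=
  sSup {x : ℝ | ∃ σ ∈ gens G n, x = dTV G σ t}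

end PR

namespace PR

/-! ### A supermartingale bound for avoiding a set -/

section Chain

variable {G : Type} [Group G] {n : ℕ}

theorem step_nonneg (σ σ' : Config G n) : 0 ≤ step G σ σ' := by
  unfold step; positivity

theorem sum_step_mul [Fintype G] (σ : Config G n) (φ : Config G n → ℝ) :
    ∑ σ', step G σ σ' * φ σ' =
      (∑ m : Move n, φ (applyMove G σ m)) / (Fintype.card (Move n) : ℝ) := by
  rw [← Finset.sum_fiberwise Finset.univ (applyMove G σ) (fun m => φ (applyMove G σ m)),
    Finset.sum_div]
  refine Finset.sum_congr rfl fun σ' _ => ?_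
  have h : ∑ m ∈ Finset.univ.filter (fun m : Move n => applyMove G σ m = σ'),
      φ (applyMove G σ m) =
      ((Finset.univ.filter (fun m : Move n => applyMove G σ m = σ')).card : ℝ) * φ σ' := by
    rw [Finset.sum_congr rfl (g := fun _ => φ σ') (fun m hm => by
      rw [(Finset.mem_filter.mp hm).2])]
    simp
  rw [h, step]
  ring

theorem applyMove_mem_gens {σ : Config G n} (hσ : σ ∈ gens G n) (m : Move n) :
    applyMove G σ m ∈ gens G n := by
  obtain ⟨⟨⟨i, j⟩, hij⟩, ε⟩ := m
  simp only [gens, Set.mem_ofPred_eq] at hσ ⊢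
  rw [eq_top_iff, ← hσ, Subgroup.closure_le]
  set σ' := applyMove G σ ⟨⟨⟨i, j⟩, hij⟩, ε⟩ with hσ'
  have hmem : ∀ l, σ' l ∈ Subgroup.closure (Set.range σ') := fun l =>
    Subgroup.subset_closure ⟨l, rfl⟩
  have hne : ∀ l, l ≠ i → σ' l = σ l := fun l hl => by
    simp [hσ', applyMove, Function.update_of_ne hl]
  have hi : σ' i = σ i * (if ε then σ j else (σ j)⁻¹) := by
    simp [hσ', applyMove]
  have hj : σ j ∈ Subgroup.closure (Set.range σ') := hne j (Ne.symm hij) ▸ hmem j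
  rintro _ ⟨l, rfl⟩
  by_cases hl : l = i
  · subst hl
    have h := hmem l
    rw [hi] at h
    refine (Subgroup.mul_mem_cancel_right _ ?_).mp h
    split_ifs
    · exact hj
    · exact inv_mem hj
  · exact hne l hl ▸ hmem l

theorem pathProb_zero_le [Fintype G] (σ : Config G n) (E : Set (Fin (0 + 1) → Config G n)) :
    pathProb G σ 0 E ≤ if (fun _ => σ) ∈ E then 1 else 0 := by
  have hconst : ∀ p : Fin (0 + 1) → Config G n, p 0 = σ → p = fun _ => σ := fun p hp => by
    funext t
    rw [Fin.fin_one_eq_zero t]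
    exact hp
  unfold pathProb
  split_ifs with h
  · simp only [Finset.univ_eq_empty, Finset.prod_empty, Finset.sum_const, nsmul_eq_mul, mul_one]
    norm_cast
    rw [Finset.card_le_one]
    intro a ha b hb
    exact (hconst a (Finset.mem_filter.mp ha).2.1).trans
      (hconst b (Finset.mem_filter.mp hb).2.1).symm
  · refine le_of_eq (Finset.sum_eq_zero fun p hp => ?_)
    obtain ⟨h0, hp⟩ := (Finset.mem_filter.mp hp).2
    exact absurd (hconst p h0 ▸ hp) h

theorem pathProb_avoid_zero [Fintype G] (σ : Config G n) (B : Set (Config G n)) :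
    pathProb G σ 0 {p | ∀ t, p t ∉ B} ≤ if σ ∈ B then 0 else 1 := by
  refine (pathProb_zero_le σ _).trans (le_of_eq ?_)
  by_cases h : σ ∈ B <;> simp [h]

theorem pathProb_avoid_succ [Fintype G] (σ : Config G n) (T : ℕ) (B : Set (Config G n)) :
    pathProb G σ (T + 1) {p | ∀ t, p t ∉ B} =
      if σ ∈ B then 0 else
        ∑ σ', step G σ σ' * pathProb G σ' T {p | ∀ t, p t ∉ B} := by
  unfold pathProb
  simp only [Finset.sum_filter, Set.mem_ofPred_eq]
  rw [← (Fin.consEquiv (fun _ : Fin (T + 1 + 1) => Config G n)).sum_comp,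
    Fintype.sum_prod_type]
  simp only [Fin.consEquiv_apply, Fin.cons_zero]
  rw [Finset.sum_eq_single σ]
  · split_ifs with h
    · refine Finset.sum_eq_zero fun p _ => if_neg ?_
      rintro ⟨-, hp⟩
      exact hp 0 (by simpa using h)
    · simp only [Finset.mul_sum]
      rw [Finset.sum_comm]
      refine Finset.sum_congr rfl fun p _ => ?_
      rw [Finset.sum_eq_single (p 0)]
      · have hiff : (∀ t, (Fin.cons σ p : Fin (T + 1 + 1) → Config G n) t ∉ B) ↔
            ∀ t, p t ∉ B := by
          rw [Fin.forall_fin_succ]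
          simp [h]
        rw [Fin.prod_univ_succ]
        simp only [hiff, true_and, mul_ite, mul_zero]
        rfl
      · intro σ' _ hne
        rw [if_neg (fun hh => hne hh.1.symm), mul_zero]
      · simp
  · intro σ' _ hne
    exact Finset.sum_eq_zero fun p _ => if_neg fun hh => hne hh.1
  · simp

/-- If `φ` contracts by a factor `r` in mean outside `B` and is at least `v` there, then `B` is
avoided up to time `T` with probability at most `r ^ T * φ σ / v`. -/
theorem pathProb_avoid_le [Fintype G] (B : Set (Config G n)) (φ : Config G n → ℝ) (r v : ℝ)
    (hr : 0 ≤ r) (hφ : ∀ σ, 0 ≤ φ σ)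
    (hv : ∀ σ ∈ gens G n, σ ∉ B → v ≤ φ σ)
    (hstep : ∀ σ ∈ gens G n, σ ∉ B →
      (∑ m : Move n, φ (applyMove G σ m)) / (Fintype.card (Move n) : ℝ) ≤ r * φ σ)
    (hv0 : 0 < v) (T : ℕ) :
    ∀ σ ∈ gens G n, pathProb G σ T {p | ∀ t, p t ∉ B} ≤ r ^ T * φ σ / v := by
  induction T with
  | zero =>
    intro σ hσ
    refine (pathProb_avoid_zero σ B).trans ?_
    split_ifs with h
    · have := hφ σ
      positivity
    · rw [pow_zero, one_mul, le_div_iff₀ hv0, one_mul]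
      exact hv σ hσ h
  | succ T ih =>
    intro σ hσ
    rw [pathProb_avoid_succ]
    split_ifs with h
    · have := hφ σ
      positivity
    · calc ∑ σ', step G σ σ' * pathProb G σ' T {p | ∀ t, p t ∉ B}
          ≤ ∑ σ', step G σ σ' * (r ^ T * φ σ' / v) := by
            refine Finset.sum_le_sum fun σ' _ => ?_
            by_cases hs : ∃ m, applyMove G σ m = σ'
            · obtain ⟨m, rfl⟩ := hs
              exact mul_le_mul_of_nonneg_left (ih _ (applyMove_mem_gens hσ m))
                (step_nonneg _ _)
            · have h0 : step G σ σ' = 0 := by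
                push Not at hs
                simp [step, hs]
              simp [h0]
        _ = r ^ T / v * ∑ σ', step G σ σ' * φ σ' := by
            rw [Finset.mul_sum]
            exact Finset.sum_congr rfl fun _ _ => by ring
        _ ≤ r ^ T / v * (r * φ σ) := by
            rw [sum_step_mul]
            exact mul_le_mul_of_nonneg_left (hstep σ hσ h) (by positivity)
        _ = r ^ (T + 1) * φ σ / v := by ring

end Chain

/-! ### The potential -/

/-- The sequence `Γ(k - 1/2) / (Γ(1/2) Γ(k))` for `k ≥ 1`. -/
def gammaRatio : ℕ → ℝ
  | 0 => 1
  | k + 1 => gammaRatio k * (1 - 1 / (2 * k))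

theorem gammaRatio_pos (k : ℕ) : 0 < gammaRatio k := by
  induction k with
  | zero => simp [gammaRatio]
  | succ k ih =>
    refine mul_pos ih ?_
    rcases Nat.eq_zero_or_pos k with rfl | hk
    · simp
    · have hk' : (1 : ℝ) ≤ k := by exact_mod_cast hk
      rw [sub_pos, div_lt_one (by positivity)]
      linarith

theorem gammaRatio_antitone : Antitone gammaRatio := by
  refine antitone_nat_of_succ_le fun k => ?_
  have h := gammaRatio_pos k
  have h2 : (0 : ℝ) ≤ 1 / (2 * k) := by positivity
  rw [gammaRatio]
  nlinarith

theorem gammaRatio_le_one (k : ℕ) : gammaRatio k ≤ 1 :=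
  gammaRatio_antitone (Nat.zero_le k)

theorem one_le_gammaRatio_sq {k : ℕ} (hk : 1 ≤ k) : 1 ≤ gammaRatio k ^ 2 * (4 * k - 3) := by
  induction k, hk using Nat.le_induction with
  | base => norm_num [gammaRatio]
  | succ k hk ih =>
    have hk' : (1 : ℝ) ≤ k := by exact_mod_cast hk
    refine ih.trans ?_
    rw [gammaRatio, mul_pow, mul_assoc]
    refine mul_le_mul_of_nonneg_left ?_ (sq_nonneg _)
    have : (1 - 1 / (2 * (k : ℝ))) ^ 2 * (4 * ((k + 1 : ℕ) : ℝ) - 3) - (4 * k - 3) =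
        1 / (4 * k ^ 2) := by
      push_cast
      field_simp
      ring
    have h2 : (0 : ℝ) ≤ 1 / (4 * (k : ℝ) ^ 2) := by positivity
    linarith

/-- The potential of a subgroup with `k` of the `n` sites outside it. -/
def potential (n k : ℕ) : ℝ := gammaRatio k * (max ((n : ℝ) - 2 * k) 0) ^ 2

theorem potential_nonneg (n k : ℕ) : 0 ≤ potential n k :=
  mul_nonneg (gammaRatio_pos k).le (sq_nonneg _)

theorem potential_antitone (n : ℕ) : Antitone (potential n) := by
  intro a b hab
  have hab' : (a : ℝ) ≤ b := by exact_mod_cast hab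
  unfold potential
  have := gammaRatio_antitone hab
  have := gammaRatio_pos a
  gcongr

theorem potential_le (n k : ℕ) : potential n k ≤ n ^ 2 := by
  have h1 : max ((n : ℝ) - 2 * k) 0 ≤ n := by
    refine max_le ?_ (by positivity)
    have : (0 : ℝ) ≤ k := by positivity
    linarith
  have h2 : (max ((n : ℝ) - 2 * k) 0) ^ 2 ≤ (n : ℝ) ^ 2 := by gcongr
  have h3 := gammaRatio_le_one k
  have h4 := gammaRatio_pos k
  unfold potential
  nlinarith [sq_nonneg (max ((n : ℝ) - 2 * k) 0)]

theorem potential_drift_one {n : ℕ} (hn : 100 ≤ n) :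
    ((n : ℝ) - 1) * (potential n 2 - potential n 1) ≤ -((n - 1) / 2) * potential n 1 := by
  have hn' : (100 : ℝ) ≤ n := by exact_mod_cast hn
  have h1 : gammaRatio 1 = 1 := by norm_num [gammaRatio]
  have h2 : gammaRatio 2 = 1 / 2 := by norm_num [gammaRatio]
  unfold potential
  rw [h1, h2]
  push_cast
  rw [max_eq_left (by linarith), max_eq_left (by linarith)]
  nlinarith [mul_nonneg (show (0 : ℝ) ≤ n - 1 by linarith) (show (0 : ℝ) ≤ n - 3 by linarith)]

/-- The polynomial inequality behind the drift bound, in terms of `w = n - 2k`. -/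
theorem drift_polynomial_le {k w : ℝ} (hk : 2 ≤ k) :
    (k + w) * k * ((1 - 1 / (2 * k)) * (w - 2) ^ 2 - w ^ 2) +
        k * (k - 1) * ((1 + 1 / (2 * k - 3)) * (w + 2) ^ 2 - w ^ 2) ≤
      -((w + 2 * k - 1) / 2) * w ^ 2 +
        (-3 * w ^ 2 * k + 5 / 2 * w ^ 2 + 4 * w * k + 8 * k ^ 2 - 4 * k + 2 * w + 4) := by
  have h1 : k * (k - 1) * (1 / (2 * k - 3)) ≤ k / 2 + 1 := by
    rw [mul_one_div, div_le_iff₀ (by linarith)]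
    nlinarith
  have h2 : k * (1 - 1 / (2 * k)) = k - 1 / 2 := by
    field_simp
  have h3 := mul_le_mul_of_nonneg_right h1 (sq_nonneg (w + 2))
  have e1 : (k + w) * k * ((1 - 1 / (2 * k)) * (w - 2) ^ 2 - w ^ 2) =
      (k + w) * ((k * (1 - 1 / (2 * k))) * (w - 2) ^ 2 - k * w ^ 2) := by ring
  have e2 : k * (k - 1) * ((1 + 1 / (2 * k - 3)) * (w + 2) ^ 2 - w ^ 2) =
      k * (k - 1) * ((w + 2) ^ 2 - w ^ 2) +
        k * (k - 1) * (1 / (2 * k - 3)) * (w + 2) ^ 2 := by ring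
  rw [e1, e2, h2]
  linarith

theorem drift_boundary_le {n k w γ : ℝ} (hn : 1 ≤ n) (hk : 2 ≤ k) (hkn : k ≤ n) (hw2 : w < 2)
    (hγ : 0 ≤ γ) :
    (n - k) * k * (γ * (1 - 1 / (2 * k)) * 0 ^ 2 - γ * (max w 0) ^ 2) +
        k * (k - 1) * (γ * (1 + 1 / (2 * k - 3)) * (max (w + 2) 0) ^ 2 - γ * (max w 0) ^ 2) ≤
      -((n - 1) / 2) * (γ * (max w 0) ^ 2) + 40 * n ^ 2 * γ := by
  have b1 : (max w 0) ^ 2 ≤ 2 ^ 2 := by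
    gcongr
    exact max_le hw2.le (by norm_num)
  have b2 : (max (w + 2) 0) ^ 2 ≤ 4 ^ 2 := by
    gcongr
    exact max_le (by linarith) (by norm_num)
  have b3 : 1 + 1 / (2 * k - 3) ≤ 2 := by
    have : 1 / (2 * k - 3) ≤ 1 := by
      rw [div_le_one (by linarith)]
      linarith
    linarith
  have b4 : k * (k - 1) ≤ n * n := by
    refine mul_le_mul hkn ?_ ?_ ?_ <;> linarith
  have b4' : 0 ≤ k * (k - 1) := mul_nonneg (by linarith) (by linarith)
  have b0 : 0 ≤ γ * (max w 0) ^ 2 := by positivity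
  have b1' : γ * (max w 0) ^ 2 ≤ γ * 2 ^ 2 := by gcongr
  have b5 : γ * (1 + 1 / (2 * k - 3)) * (max (w + 2) 0) ^ 2 ≤ γ * 2 * 4 ^ 2 := by gcongr
  generalize γ * (max w 0) ^ 2 = x at *
  generalize γ * (1 + 1 / (2 * k - 3)) * (max (w + 2) 0) ^ 2 = y at *
  have c1 : (n - k) * k * (γ * (1 - 1 / (2 * k)) * 0 ^ 2 - x) ≤ 0 := by
    refine mul_nonpos_of_nonneg_of_nonpos (mul_nonneg (by linarith) (by linarith)) ?_
    rw [zero_pow two_ne_zero, mul_zero]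
    linarith
  have c2 : k * (k - 1) * (y - x) ≤ n * n * (γ * 2 * 4 ^ 2) :=
    calc k * (k - 1) * (y - x) ≤ k * (k - 1) * (γ * 2 * 4 ^ 2) :=
          mul_le_mul_of_nonneg_left (by linarith) b4'
      _ ≤ _ := by gcongr
  have c3 : (n - 1) / 2 * x ≤ n * (γ * 2 ^ 2) := by
    refine mul_le_mul ?_ b1' b0 ?_ <;> linarith
  have c4 : n * γ ≤ n * (n * γ) :=
    mul_le_mul_of_nonneg_left (le_mul_of_one_le_left hγ hn) (by linarith)
  have c5 : 0 ≤ n * γ := mul_nonneg (by linarith) hγ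
  linarith

theorem potential_drift {n k : ℕ} (hn : 100 ≤ n) (hk : 1 ≤ k) (hkn : k ≤ n) :
    ((n : ℝ) - k) * k * (potential n (k + 1) - potential n k) +
        k * (k - 1) * (potential n (k - 1) - potential n k) ≤
      -((n - 1) / 2) * potential n k +
        if 2 * n ≤ 5 * k then 40 * n ^ 2 * gammaRatio k else 0 := by
  have hn' : (100 : ℝ) ≤ n := by exact_mod_cast hn
  rcases hk.eq_or_lt with rfl | hk2
  · have h := potential_drift_one hn
    have hif : ¬ (2 * n ≤ 5 * 1) := by omega
    rw [if_neg hif]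
    push_cast
    linarith
  obtain ⟨l, rfl⟩ : ∃ l, k = l + 1 := ⟨k - 1, by omega⟩
  have hl : (1 : ℝ) ≤ l := by exact_mod_cast (by omega : 1 ≤ l)
  have hkn' : ((l + 1 : ℕ) : ℝ) ≤ n := by exact_mod_cast hkn
  have hg := gammaRatio_pos (l + 1)
  have hgl : gammaRatio l = gammaRatio (l + 1) * (1 + 1 / (2 * ((l + 1 : ℕ) : ℝ) - 3)) := by
    have : (2 * (l : ℝ) - 1) ≠ 0 := by linarith
    have h3 : (2 * ((l : ℝ) + 1) - 3) ≠ 0 := by linarith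
    have h4 : (l : ℝ) ≠ 0 := by linarith
    rw [show gammaRatio (l + 1) = gammaRatio l * (1 - 1 / (2 * l)) from rfl]
    push_cast
    have : (1 - 1 / (2 * (l : ℝ))) * (1 + 1 / (2 * ((l : ℝ) + 1) - 3)) = 1 := by
      field_simp
      ring
    rw [mul_assoc, this, mul_one]
  have hgk : gammaRatio (l + 1 + 1) =
      gammaRatio (l + 1) * (1 - 1 / (2 * ((l + 1 : ℕ) : ℝ))) := rfl
  rw [Nat.add_sub_cancel]
  unfold potential
  rw [hgk, hgl]
  have hcl : (l : ℝ) = ((l + 1 : ℕ) : ℝ) - 1 := by push_cast; ring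
  have hck : ((l + 1 + 1 : ℕ) : ℝ) = ((l + 1 : ℕ) : ℝ) + 1 := by push_cast; ring
  rw [hcl, hck]
  have hk' : (2 : ℝ) ≤ ((l + 1 : ℕ) : ℝ) := by push_cast; linarith
  have hcond : 2 * n ≤ 5 * (l + 1) ↔ 2 * (n : ℝ) ≤ 5 * ((l + 1 : ℕ) : ℝ) := by
    exact_mod_cast Iff.rfl
  rw [if_congr hcond rfl rfl]
  generalize ((l + 1 : ℕ) : ℝ) = k at *
  generalize gammaRatio (l + 1) = γ at *
  obtain ⟨w, hw⟩ : ∃ w : ℝ, w = n - 2 * k := ⟨_, rfl⟩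
  have e1 : (n : ℝ) - 2 * (k + 1) = w - 2 := by linarith
  have e2 : (n : ℝ) - 2 * (k - 1) = w + 2 := by linarith
  rw [e1, e2, ← hw]
  rcases le_or_gt 2 w with hw2 | hw2
  · rw [max_eq_left (by linarith), max_eq_left (by linarith), max_eq_left (by linarith)]
    have h := mul_le_mul_of_nonneg_left (drift_polynomial_le (w := w) hk') hg.le
    have hE : γ * (-3 * w ^ 2 * k + 5 / 2 * w ^ 2 + 4 * w * k + 8 * k ^ 2 - 4 * k + 2 * w + 4) ≤
        if 2 * (n : ℝ) ≤ 5 * k then 40 * n ^ 2 * γ else 0 := by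
      split_ifs with hc
      · rw [mul_comm (40 * (n : ℝ) ^ 2) γ]
        refine mul_le_mul_of_nonneg_left ?_ hg.le
        have a1 : w * k ≤ n * n := by
          have : w ≤ n := by linarith
          gcongr
        have a2 : k ^ 2 ≤ n ^ 2 := by gcongr
        have a3 : 0 ≤ w ^ 2 * (k - 2) := mul_nonneg (sq_nonneg _) (by linarith)
        nlinarith
      · push Not at hc
        refine mul_nonpos_of_nonneg_of_nonpos hg.le ?_
        have hw20 : 20 ≤ w := by linarith
        have hkw : k ≤ 2 * w := by linarith
        have a1 : k * k ≤ 2 * w * k := by gcongr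
        have a2 : 20 * (w * k) ≤ w * (w * k) := by gcongr
        have a3 : w * 2 ≤ w * k := by gcongr
        have a4 : 0 ≤ w ^ 2 * (k - 2) := mul_nonneg (sq_nonneg _) (by linarith)
        nlinarith
    have hn2 : (n : ℝ) = w + 2 * k := by linarith
    have e3 : ((n : ℝ) - k) = k + w := by linarith
    rw [e3]
    have e4 : ((n : ℝ) - 1) / 2 = (w + 2 * k - 1) / 2 := by rw [hn2]
    rw [e4]
    linarith
  · rw [max_eq_right (show w - 2 ≤ 0 by linarith), if_pos (by linarith)]
    exact drift_boundary_le (by linarith) hk' hkn' hw2 hg.le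

section Drift

variable {G : Type} [Group G] {n : ℕ}

/-- The indicator that site `i` lies outside `H`. -/
def outside (H : Subgroup G) (σ : Config G n) (i : Fin n) : ℝ := if σ i ∈ H then 0 else 1

theorem outside_mul_self (H : Subgroup G) (σ : Config G n) (i : Fin n) :
    outside H σ i * outside H σ i = outside H σ i := by
  unfold outside
  split_ifs <;> simp

theorem sum_outside (H : Subgroup G) (σ : Config G n) :
    ∑ i, outside H σ i = (nNon G H σ : ℝ) := by
  unfold outside nNon
  rw [Finset.card_filter]
  push_cast
  exact Finset.sum_congr rfl fun i _ => by split_ifs <;> simp_all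

theorem nNon_le (H : Subgroup G) (σ : Config G n) : nNon G H σ ≤ n :=
  (Finset.card_filter_le _ _).trans (by simp)

theorem nNon_applyMove (H : Subgroup G) (σ : Config G n) (m : Move n) :
    (nNon G H (applyMove G σ m) : ℝ) = nNon G H σ - outside H σ m.1.1.1 +
      outside H (applyMove G σ m) m.1.1.1 := by
  rw [← sum_outside, ← sum_outside, ← Finset.add_sum_erase _ _ (Finset.mem_univ m.1.1.1),
    ← Finset.add_sum_erase _ (outside H σ) (Finset.mem_univ m.1.1.1)]
  have : ∑ i ∈ Finset.univ.erase m.1.1.1, outside H (applyMove G σ m) i =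
      ∑ i ∈ Finset.univ.erase m.1.1.1, outside H σ i := by
    refine Finset.sum_congr rfl fun i hi => ?_
    simp [outside, applyMove, Function.update_of_ne (Finset.ne_of_mem_erase hi)]
  rw [this]
  ring

theorem one_le_nNon {σ : Config G n} (hσ : σ ∈ gens G n) {H : Subgroup G} (hH : H ≠ ⊤) :
    1 ≤ nNon G H σ := by
  by_contra hlt
  have h0 : nNon G H σ = 0 := by omega
  refine hH (eq_top_iff.mpr ?_)
  have hσ' : Subgroup.closure (Set.range σ) = ⊤ := hσ
  rw [← hσ', Subgroup.closure_le]
  rintro _ ⟨i, rfl⟩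
  by_contra hi
  have := Finset.filter_eq_empty_iff.mp (Finset.card_eq_zero.mp h0) (Finset.mem_univ i)
  exact this hi

theorem apply_nNon_applyMove_le {f : ℕ → ℝ} (hf : Antitone f) (H : Subgroup G)
    (σ : Config G n) (m : Move n) :
    f (nNon G H (applyMove G σ m)) ≤ f (nNon G H σ) +
      (1 - outside H σ m.1.1.1) * outside H σ m.1.1.2 *
        (f (nNon G H σ + 1) - f (nNon G H σ)) +
      outside H σ m.1.1.1 * outside H σ m.1.1.2 *
        (f (nNon G H σ - 1) - f (nNon G H σ)) := by
  have hm := nNon_applyMove H σ m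
  have hval : applyMove G σ m m.1.1.1 =
      σ m.1.1.1 * (if m.2 then σ m.1.1.2 else (σ m.1.1.2)⁻¹) := by
    simp [applyMove]
  have hs : (if m.2 then σ m.1.1.2 else (σ m.1.1.2)⁻¹) ∈ H ↔ σ m.1.1.2 ∈ H := by
    split_ifs
    · rfl
    · exact inv_mem_iff
  unfold outside at hm ⊢
  rw [hval] at hm
  by_cases hi : σ m.1.1.1 ∈ H <;> by_cases hj : σ m.1.1.2 ∈ H
  · rw [if_pos hi, if_pos ((H.mul_mem_cancel_left hi).mpr (hs.mpr hj))] at hm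
    have : nNon G H (applyMove G σ m) = nNon G H σ := by
      have := hm; norm_num at this; exact_mod_cast this
    simp [hj, this]
  · rw [if_pos hi, if_neg (fun h => hj (hs.mp ((H.mul_mem_cancel_left hi).mp h)))] at hm
    have : nNon G H (applyMove G σ m) = nNon G H σ + 1 := by
      have := hm; norm_num at this; exact_mod_cast this
    simp [hi, hj, this]
  · rw [if_neg hi, if_neg (fun h => hi ((H.mul_mem_cancel_right (hs.mpr hj)).mp h))] at hm
    have : nNon G H (applyMove G σ m) = nNon G H σ := by
      have := hm; norm_num at this; exact_mod_cast this
    simp [hj, this]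
  · have hle : nNon G H σ - 1 ≤ nNon G H (applyMove G σ m) := by
      rw [if_neg hi] at hm
      have h0 : (0 : ℝ) ≤ if σ m.1.1.1 * (if m.2 then σ m.1.1.2 else (σ m.1.1.2)⁻¹) ∈ H
        then 0 else 1 := by split_ifs <;> norm_num
      have : (nNon G H σ : ℝ) ≤ ((nNon G H (applyMove G σ m) + 1 : ℕ) : ℝ) := by
        push_cast
        linarith
      have := Nat.cast_le.mp this
      omega
    simp [hi, hj, hf hle]

theorem sum_move (h : Fin n → Fin n → ℝ) :
    ∑ m : Move n, h m.1.1.1 m.1.1.2 = 2 * (∑ i, ∑ j, h i j - ∑ i, h i i) := by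
  rw [Fintype.sum_prod_type]
  simp only [Finset.sum_const, Finset.card_univ, Fintype.card_bool, nsmul_eq_mul]
  rw [← Finset.mul_sum]
  push_cast
  congr 1
  have hsub : ∑ p : {p : Fin n × Fin n // p.1 ≠ p.2}, h p.1.1 p.1.2 =
      ∑ p ∈ Finset.univ.filter (fun p : Fin n × Fin n => p.1 ≠ p.2), h p.1 p.2 :=
    (Finset.sum_subtype (Finset.univ.filter (fun p : Fin n × Fin n => p.1 ≠ p.2))
      (fun p => by simp) (fun p => h p.1 p.2)).symm
  rw [hsub, Finset.sum_filter, Fintype.sum_prod_type, ← Finset.sum_sub_distrib]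
  refine Finset.sum_congr rfl fun i _ => ?_
  rw [eq_sub_iff_add_eq, ← Finset.sum_filter, ← Finset.add_sum_erase _ _ (Finset.mem_univ i),
    add_comm]
  congr 1
  refine Finset.sum_congr ?_ fun _ _ => rfl
  ext j
  simp [eq_comm]

theorem card_move : (Fintype.card (Move n) : ℝ) = 2 * (n * (n - 1)) := by
  have h := sum_move (n := n) fun _ _ => 1
  simp only [Finset.sum_const, Finset.card_univ, nsmul_eq_mul, mul_one, Fintype.card_fin] at h
  rw [h]
  ring

theorem sum_apply_nNon_applyMove_le {f : ℕ → ℝ} (hf : Antitone f) (H : Subgroup G)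
    (σ : Config G n) :
    ∑ m : Move n, f (nNon G H (applyMove G σ m)) ≤ 2 * (n * (n - 1) * f (nNon G H σ) +
      ((n - nNon G H σ) * nNon G H σ * (f (nNon G H σ + 1) - f (nNon G H σ)) +
      nNon G H σ * (nNon G H σ - 1) * (f (nNon G H σ - 1) - f (nNon G H σ)))) := by
  refine (Finset.sum_le_sum fun m _ => apply_nNon_applyMove_le hf H σ m).trans (le_of_eq ?_)
  rw [sum_move (fun i j => f (nNon G H σ) +
      (1 - outside H σ i) * outside H σ j * (f (nNon G H σ + 1) - f (nNon G H σ)) +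
      outside H σ i * outside H σ j * (f (nNon G H σ - 1) - f (nNon G H σ)))]
  have hdiag : ∀ i, (1 - outside H σ i) * outside H σ i = 0 := fun i => by
    rw [sub_mul, outside_mul_self, one_mul, sub_self]
  simp only [outside_mul_self, hdiag, zero_mul, add_zero, Finset.sum_add_distrib,
    ← Finset.sum_mul, ← Finset.mul_sum, Finset.sum_sub_distrib, sum_outside, Finset.sum_const,
    Finset.card_univ, nsmul_eq_mul, mul_one, Fintype.card_fin]
  ring

variable [Fintype G]

/-- The sum of the potentials of all proper subgroups. -/
def totalPotential (σ : Config G n) : ℝ :=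
  ∑ H ∈ Finset.univ.filter (fun H : Subgroup G => H ≠ ⊤), potential n (nNon G H σ)

theorem totalPotential_nonneg (σ : Config G n) : 0 ≤ totalPotential σ :=
  Finset.sum_nonneg fun _ _ => potential_nonneg _ _

theorem totalPotential_le (σ : Config G n) :
    totalPotential σ ≤ Fintype.card (Subgroup G) * (n : ℝ) ^ 2 := by
  refine (Finset.sum_le_card_nsmul _ _ _ fun H _ => potential_le n _).trans ?_
  rw [nsmul_eq_mul]
  gcongr
  exact Finset.card_filter_le _ _

theorem exists_gammaRatio_mul_le {σ : Config G n} (hσ : σ ∈ gens G n)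
    (hbad : σ ∉ SNon G n (1 / 3)) :
    ∃ k : ℕ, 1 ≤ k ∧ 3 * k < n ∧ gammaRatio k * n ^ 2 ≤ 9 * totalPotential σ := by
  obtain ⟨H, hH, hlt⟩ : ∃ H : Subgroup G, H ≠ ⊤ ∧ (nNon G H σ : ℝ) < 1 / 3 * n := by
    by_contra hcon
    push Not at hcon
    exact hbad ⟨hσ, hcon⟩
  refine ⟨nNon G H σ, one_le_nNon hσ hH, ?_, ?_⟩
  · have : (3 : ℝ) * nNon G H σ < n := by linarith
    exact_mod_cast this
  have h1 : potential n (nNon G H σ) ≤ totalPotential σ :=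
    Finset.single_le_sum (f := fun H => potential n (nNon G H σ))
      (fun _ _ => potential_nonneg _ _) (by simpa using hH)
  have h2 : (1 / 3 * (n : ℝ)) ^ 2 ≤ (max ((n : ℝ) - 2 * nNon G H σ) 0) ^ 2 := by
    gcongr
    refine le_trans ?_ (le_max_left _ _)
    linarith
  have h3 := mul_le_mul_of_nonneg_left h2 (gammaRatio_pos (nNon G H σ)).le
  unfold potential at h1
  linarith

theorem le_totalPotential {σ : Config G n} (hn : 0 < n) (hσ : σ ∈ gens G n)
    (hbad : σ ∉ SNon G n (1 / 3)) :
    (n : ℝ) ^ 2 / (18 * Real.sqrt n) ≤ totalPotential σ := by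
  obtain ⟨k, hk1, hk, hle⟩ := exists_gammaRatio_mul_le hσ hbad
  have hn' : (0 : ℝ) < n := by exact_mod_cast hn
  have hs : 0 < Real.sqrt n := Real.sqrt_pos.mpr hn'
  have hg := gammaRatio_pos k
  have hkn : (k : ℝ) ≤ n := by exact_mod_cast (by omega : k ≤ n)
  have h1 : 1 ≤ 2 * Real.sqrt n * gammaRatio k := by
    rw [← one_le_sq_iff₀ (by positivity), mul_pow, mul_pow, Real.sq_sqrt hn'.le]
    have := one_le_gammaRatio_sq hk1
    nlinarith [mul_le_mul_of_nonneg_left hkn (sq_nonneg (gammaRatio k)),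
      sq_nonneg (gammaRatio k)]
  rw [div_le_iff₀ (by positivity)]
  calc (n : ℝ) ^ 2 ≤ 2 * Real.sqrt n * gammaRatio k * n ^ 2 :=
        le_mul_of_one_le_left (by positivity) h1
    _ = 2 * Real.sqrt n * (gammaRatio k * n ^ 2) := by ring
    _ ≤ 2 * Real.sqrt n * (9 * totalPotential σ) := by gcongr
    _ = _ := by ring

theorem totalPotential_drift (hn : 100 ≤ n) {σ : Config G n} (hσ : σ ∈ gens G n)
    (hbad : σ ∉ SNon G n (1 / 3)) :
    (∑ m : Move n, totalPotential (applyMove G σ m)) / (Fintype.card (Move n) : ℝ) ≤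
      (1 - 1 / (2 * n) + 720 * Fintype.card (Subgroup G) / n ^ 2) * totalPotential σ := by
  obtain ⟨k₀, hk₀1, hk₀, hle⟩ := exists_gammaRatio_mul_le hσ hbad
  have hn' : (100 : ℝ) ≤ n := by exact_mod_cast hn
  have hV := totalPotential_nonneg σ
  have hH : ∀ H ∈ Finset.univ.filter (fun H : Subgroup G => H ≠ ⊤),
      ∑ m : Move n, potential n (nNon G H (applyMove G σ m)) ≤
        2 * ((n * (n - 1) - (n - 1) / 2) * potential n (nNon G H σ)) +
          720 * totalPotential σ := by
    intro H hH
    have hH : H ≠ ⊤ := by simpa using hH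
    refine (sum_apply_nNon_applyMove_le (potential_antitone n) H σ).trans ?_
    have hd := potential_drift hn (one_le_nNon hσ hH) (nNon_le H σ)
    have hE : (if 2 * n ≤ 5 * nNon G H σ then 40 * (n : ℝ) ^ 2 * gammaRatio (nNon G H σ) else 0)
        ≤ 360 * totalPotential σ := by
      split_ifs with hc
      · have hanti := gammaRatio_antitone (by omega : k₀ ≤ nNon G H σ)
        have := mul_le_mul_of_nonneg_right hanti (sq_nonneg (n : ℝ))
        linarith
      · positivity
    linarith
  have hsum := Finset.sum_le_sum hH
  rw [Finset.sum_comm, Finset.sum_add_distrib, ← Finset.mul_sum, ← Finset.mul_sum,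
    Finset.sum_const, nsmul_eq_mul] at hsum
  change ∑ m : Move n, totalPotential (applyMove G σ m) ≤
    2 * ((n * (n - 1) - (n - 1) / 2) * totalPotential σ) + _ at hsum
  have hcard : ((Finset.univ.filter (fun H : Subgroup G => H ≠ ⊤)).card : ℝ) ≤
      Fintype.card (Subgroup G) := by
    exact_mod_cast Finset.card_filter_le _ _
  have hcard' := mul_le_mul_of_nonneg_right hcard
    (show 0 ≤ 720 * totalPotential σ by positivity)
  rw [card_move, div_le_iff₀ (by nlinarith)]
  refine (hsum.trans (add_le_add_right hcard' _)).trans ?_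
  generalize totalPotential σ = V at *
  generalize (Fintype.card (Subgroup G) : ℝ) = M at *
  have hM : 0 ≤ M := le_trans (by positivity) hcard
  have e : (1 - 1 / (2 * (n : ℝ)) + 720 * M / n ^ 2) * V * (2 * (n * (n - 1))) =
      2 * ((n * (n - 1) - (n - 1) / 2) * V) + M * (720 * V) * (2 * (n - 1) / n) := by
    field_simp
  rw [e]
  refine add_le_add_right (le_mul_of_one_le_right (by positivity) ?_) _
  rw [one_le_div (by linarith)]
  linarith

end Drift

/-! ### Estimates for the number of steps -/

theorem pow_floor_le {n : ℕ} {β M : ℝ} (hn : 1 ≤ n) (hβ : 0 ≤ β) (hM : 0 ≤ M)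
    (hhalf : 1440 * M / n ≤ 1 / 2) (hlog : 1440 * M * (Real.log n / n) ≤ 1) :
    (1 - 1 / (2 * (n : ℝ)) + 720 * M / n ^ 2) ^ ⌊(n : ℝ) * Real.log n + β * n⌋₊ ≤
      Real.exp (1 - β / 4) / Real.sqrt n := by
  have hn' : (1 : ℝ) ≤ n := by exact_mod_cast hn
  have hn0 : (0 : ℝ) < n := by linarith
  have hl : 0 ≤ Real.log n := Real.log_nonneg hn'
  set T := ⌊(n : ℝ) * Real.log n + β * n⌋₊ with hT
  have hTlt : (n : ℝ) * Real.log n + β * n < T + 1 := Nat.lt_floor_add_one _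
  set δ := 1440 * M / n with hδ
  have hδ0 : 0 ≤ δ := by positivity
  have hδl : δ * Real.log n ≤ 1 := by
    rw [hδ]
    calc _ = 1440 * M * (Real.log n / n) := by ring
      _ ≤ 1 := hlog
  have hr : 1 - 1 / (2 * (n : ℝ)) + 720 * M / n ^ 2 = 1 - (1 - δ) / (2 * n) := by
    rw [hδ]
    field_simp
    ring
  rw [hr]
  have hr0 : 0 ≤ 1 - (1 - δ) / (2 * (n : ℝ)) := by
    rw [sub_nonneg, div_le_one (by positivity)]
    linarith
  have hsqrt : Real.sqrt n = Real.exp (Real.log n / 2) := by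
    rw [Real.exp_half, Real.exp_log hn0]
  rw [hsqrt, ← Real.exp_sub]
  have hexp : 1 - (1 - δ) / (2 * (n : ℝ)) ≤ Real.exp (-((1 - δ) / (2 * n))) := by
    have := Real.add_one_le_exp (-((1 - δ) / (2 * (n : ℝ))))
    linarith
  refine (pow_le_pow_left₀ hr0 hexp T).trans ?_
  rw [← Real.exp_nat_mul, Real.exp_le_exp]
  have h1 : (Real.log n + β - 1) * ((1 - δ) / 2) ≤ T * ((1 - δ) / (2 * n)) := by
    have : (Real.log n + β - 1) * n ≤ T := by nlinarith
    calc (Real.log n + β - 1) * ((1 - δ) / 2)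
        = (Real.log n + β - 1) * n * ((1 - δ) / (2 * n)) := by field_simp
      _ ≤ _ := by
        refine mul_le_mul_of_nonneg_right this (div_nonneg ?_ ?_) <;> linarith
  nlinarith [mul_nonneg hβ (show 0 ≤ 1 / 2 - δ by linarith)]

theorem eventually_exp_le_div_sq (K : ℝ) {c : ℝ} (hc : 0 < c) :
    ∀ᶠ β : ℝ in atTop, K * Real.exp (1 - β / 4) ≤ c / β ^ 2 := by
  have h := (Real.tendsto_pow_mul_exp_neg_atTop_nhds_zero 2).comp
    (tendsto_id.atTop_div_const (show (0 : ℝ) < 4 by norm_num))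
  have h' := h.const_mul (K * Real.exp 1 * 16)
  rw [mul_zero] at h'
  filter_upwards [h'.eventually (gt_mem_nhds hc), eventually_gt_atTop 0] with β hβ hpos
  rw [le_div_iff₀ (by positivity), sub_eq_add_neg, Real.exp_add]
  refine le_trans (le_of_eq ?_) hβ.le
  simp only [Function.comp, id]
  ring

end PR

/-- Lemma 2.1, first part: for all large enough `n` and all large enough
`β > 0`, `max_{σ∈S} Pr_σ(τ_{1/3} > n log n + β n) ≤ 120 Q / β²`, where `τ_{1/3}` is the
hitting time of `S_non(1/3)`.  The event `τ_{1/3} > n log n + β n` is expressed as: the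
trajectory avoids `S_non(1/3)` at every time `t ≤ ⌊n log n + β n⌋`. -/
theorem hitting_SNon_onethird
    (G : Type) [Group G] [Fintype G] :
    ∃ (N : ℕ) (β₀ : ℝ), ∀ n : ℕ, N ≤ n → ∀ β : ℝ, β₀ ≤ β →
      ∀ σ ∈ PR.gens G n,
        PR.pathProb G σ ⌊(n : ℝ) * Real.log n + β * n⌋₊
          {p | ∀ t, p t ∉ PR.SNon G n (1 / 3)}
        ≤ 120 * (Fintype.card G : ℝ) / β ^ 2 := by
  have hM : (0 : ℝ) ≤ Fintype.card (Subgroup G) := by positivity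
  have hQ : (0 : ℝ) < 120 * Fintype.card G := by
    have : 0 < Fintype.card G := Fintype.card_pos
    positivity
  have hlog : Tendsto (fun n : ℕ => 1440 * (Fintype.card (Subgroup G) : ℝ) *
      (Real.log n / n)) atTop (nhds 0) := by
    have h := (Real.isLittleO_log_id_atTop.tendsto_div_nhds_zero.comp
      tendsto_natCast_atTop_atTop).const_mul (1440 * (Fintype.card (Subgroup G) : ℝ))
    rwa [mul_zero] at h
  have hhalf : Tendsto (fun n : ℕ => 1440 * (Fintype.card (Subgroup G) : ℝ) / n) atTop
      (nhds 0) := tendsto_const_div_atTop_nhds_zero_nat _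
  obtain ⟨N, hN⟩ := eventually_atTop.mp
    (((hlog.eventually (gt_mem_nhds one_pos)).and
      (hhalf.eventually (gt_mem_nhds (show (0 : ℝ) < 1 / 2 by norm_num)))).and
      (eventually_ge_atTop 100))
  obtain ⟨β₀, hβ₀⟩ := eventually_atTop.mp
    ((PR.eventually_exp_le_div_sq (18 * Fintype.card (Subgroup G)) hQ).and
      (eventually_ge_atTop 0))
  refine ⟨N, β₀, fun n hn β hβ σ hσ => ?_⟩
  obtain ⟨⟨hnlog, hnhalf⟩, hn100⟩ := hN n hn
  obtain ⟨hexp, hβ0⟩ := hβ₀ β hβ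
  have hn' : (100 : ℝ) ≤ n := by exact_mod_cast hn100
  have hs : 0 < Real.sqrt n := Real.sqrt_pos.mpr (by linarith)
  have hr : (0 : ℝ) ≤ 1 - 1 / (2 * n) + 720 * Fintype.card (Subgroup G) / n ^ 2 := by
    have h1 : 1 / (2 * (n : ℝ)) ≤ 1 := by
      rw [div_le_one (by linarith)]
      linarith
    have h2 : (0 : ℝ) ≤ 720 * Fintype.card (Subgroup G) / n ^ 2 := by positivity
    linarith
  refine (PR.pathProb_avoid_le _ PR.totalPotential _ ((n : ℝ) ^ 2 / (18 * Real.sqrt n)) hr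
    PR.totalPotential_nonneg (fun τ hτ hbad => PR.le_totalPotential (by omega) hτ hbad)
    (fun τ hτ hbad => PR.totalPotential_drift hn100 hτ hbad) (by positivity) _ σ hσ).trans ?_
  refine le_trans ?_ hexp
  rw [div_le_iff₀ (by positivity)]
  calc _ ≤ Real.exp (1 - β / 4) / Real.sqrt n * (Fintype.card (Subgroup G) * (n : ℝ) ^ 2) :=
        mul_le_mul (PR.pow_floor_le (by omega) hβ0 hM hnhalf.le hnlog.le)
          (PR.totalPotential_le σ) (PR.totalPotential_nonneg σ) (by positivity)
    _ = _ := by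
        field_simp
end
end

section
/- Let σ_* ∈ S be a configuration, and run the product replacement chain (σ_t)_{t≥0} with initial state σ_*. Let π̄^{σ_*} be the stationary measure of the Markov chain ((n^{σ_*}_{a,b}(σ_t))_{a,b∈G})_{t≥0} on {0,1,…,n}^{G×G}. Then for every t ≥ 0, the total-variation distance between the law of σ_t and π equals the total-variation distance between the law of (n^{σ_*}_{a,b}(σ_t))_{a,b∈G} and π̄^{σ_*}. -/
open scoped BigOperators
open Filter

attribute [local instance] Classical.propDecidable

noncomputable section

namespace PR

/-- Pushforward of a weight function on configurations to proportion-matrix space: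
the weight of a matrix `N : G → G → ℕ` is the total weight of configurations `σ`
with `n^{σ₀}_{a,b}(σ) = N a b` for all `a, b`. -/
def matPush (G : Type) [Group G] [Fintype G] {n : ℕ} (σ₀ : Config G n)
    (p : Config G n → ℝ) : (G → G → ℕ) → ℝ := fun N =>
  ∑ τ ∈ Finset.univ.filter (fun τ : Config G n => ∀ a b : G, nab G σ₀ τ a b = N a b), p τ

end PR

namespace PR

/-- Total variation is preserved by pushing forward along a map on whose fibers both weights
are constant. -/
theorem tvDist_eq_tvDist_push {α β : Type*} [Fintype α] (F : α → β) (p q : α → ℝ)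
    (hp : ∀ x y, F x = F y → p x = p y) (hq : ∀ x y, F x = F y → q x = q y) :
    tvDist p q = tvDist (fun b => ∑ x ∈ Finset.univ.filter (fun x => F x = b), p x)
      (fun b => ∑ x ∈ Finset.univ.filter (fun x => F x = b), q x) := by
  have push (r : α → ℝ) (B : Finset β) :
      ∑ b ∈ B, ∑ x ∈ Finset.univ.filter (fun x => F x = b), r x
        = ∑ x ∈ Finset.univ.filter (fun x => F x ∈ B), r x := by
    rw [← Finset.sum_fiberwise_of_maps_to (s := Finset.univ.filter (fun x => F x ∈ B))
      (t := B) (g := F) (fun x hx => (Finset.mem_filter.mp hx).2)]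
    refine Finset.sum_congr rfl fun b hb => Finset.sum_congr ?_ fun _ _ => rfl
    ext x
    simp only [Finset.mem_filter, Finset.mem_univ, true_and]
    exact ⟨fun h => ⟨h ▸ hb, h⟩, fun h => h.2⟩
  have bdd : ∀ A : Finset α, |∑ a ∈ A, p a - ∑ a ∈ A, q a| ≤ ∑ a, |p a - q a| := fun A => by
    rw [← Finset.sum_sub_distrib]
    exact (Finset.abs_sum_le_sum_abs _ _).trans
      (Finset.sum_le_sum_of_subset_of_nonneg (Finset.subset_univ _) fun _ _ _ => abs_nonneg _)
  have sat (P : α → Prop) (hP : ∀ x y, F x = F y → P x → P y) :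
      Finset.univ.filter (fun x => F x ∈ (Finset.univ.filter P).image F)
        = Finset.univ.filter P := by
    ext x
    simp only [Finset.mem_filter, Finset.mem_univ, true_and, Finset.mem_image]
    exact ⟨fun ⟨y, hy, h⟩ => hP y x h hy, fun h => ⟨x, h, rfl⟩⟩
  have sum_le (r : α → ℝ) (A : Finset α) :
      ∑ a ∈ A, r a ≤ ∑ a ∈ Finset.univ.filter (fun a => 0 < r a), r a := by
    rw [← Finset.sum_filter_add_sum_filter_not A (fun a => 0 < r a)]
    have h₁ : ∑ a ∈ A.filter (fun a => ¬ 0 < r a), r a ≤ 0 :=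
      Finset.sum_nonpos fun a ha => not_lt.mp (Finset.mem_filter.mp ha).2
    have h₂ : ∑ a ∈ A.filter (fun a => 0 < r a), r a
        ≤ ∑ a ∈ Finset.univ.filter (fun a => 0 < r a), r a :=
      Finset.sum_le_sum_of_subset_of_nonneg
        (Finset.filter_subset_filter _ (Finset.subset_univ _))
        fun a ha _ => (Finset.mem_filter.mp ha).2.le
    linarith
  unfold tvDist
  apply le_antisymm
  · refine csSup_le ⟨_, ∅, rfl⟩ ?_
    rintro _ ⟨A, rfl⟩
    have key (P : α → Prop) (hP : ∀ x y, F x = F y → P x → P y)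
        (h : |∑ a ∈ A, p a - ∑ a ∈ A, q a| ≤ |∑ a ∈ Finset.univ.filter P, p a
          - ∑ a ∈ Finset.univ.filter P, q a|) :
        |∑ a ∈ A, p a - ∑ a ∈ A, q a| ≤ sSup {x : ℝ | ∃ B : Finset β,
          x = |∑ b ∈ B, ∑ x ∈ Finset.univ.filter (fun x => F x = b), p x
            - ∑ b ∈ B, ∑ x ∈ Finset.univ.filter (fun x => F x = b), q x|} := by
      refine le_csSup_of_le ⟨∑ a, |p a - q a|, ?_⟩
        ⟨(Finset.univ.filter P).image F, rfl⟩ ?_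
      · rintro _ ⟨B, rfl⟩
        rw [push, push]
        exact bdd _
      · rw [push, push, sat P hP]
        exact h
    rcases abs_cases (∑ a ∈ A, p a - ∑ a ∈ A, q a) with ⟨h, -⟩ | ⟨h, -⟩
    · refine key (fun a => 0 < p a - q a) (fun x y e => by rw [hp x y e, hq x y e]; exact id) ?_
      rw [h, ← Finset.sum_sub_distrib, ← Finset.sum_sub_distrib]
      exact (sum_le (fun a => p a - q a) A).trans (le_abs_self _)
    · refine key (fun a => 0 < q a - p a) (fun x y e => by rw [hp x y e, hq x y e]; exact id) ?_
      rw [h, neg_sub, abs_sub_comm, ← Finset.sum_sub_distrib, ← Finset.sum_sub_distrib]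
      exact (sum_le (fun a => q a - p a) A).trans (le_abs_self _)
  · refine csSup_le ⟨_, ∅, rfl⟩ ?_
    rintro _ ⟨B, rfl⟩
    rw [push, push]
    refine le_csSup ⟨∑ a, |p a - q a|, ?_⟩ ⟨_, rfl⟩
    rintro _ ⟨A, rfl⟩
    exact bdd A

/-- The action of a permutation of the sites on moves. -/
def moveEquiv {n : ℕ} (e : Equiv.Perm (Fin n)) : Move n ≃ Move n :=
  Equiv.prodCongr
    ((Equiv.prodCongr e e).subtypeEquiv fun _ => e.injective.ne_iff.symm) (Equiv.refl _)

theorem applyMove_comp_perm (G : Type) [Group G] {n : ℕ} (e : Equiv.Perm (Fin n))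
    (τ : Config G n) (m : Move n) :
    applyMove G (τ ∘ e) m = applyMove G τ (moveEquiv e m) ∘ e := by
  have h₁ : (moveEquiv e m).1.1.1 = e m.1.1.1 := rfl
  have h₂ : (moveEquiv e m).1.1.2 = e m.1.1.2 := rfl
  have h₃ : (moveEquiv e m).2 = m.2 := rfl
  funext k
  by_cases h : k = m.1.1.1
  · subst h
    simp [applyMove, h₁, h₂, h₃]
  · simp [applyMove, h₁, h]

theorem step_comp_perm (G : Type) [Group G] [Fintype G] {n : ℕ} (e : Equiv.Perm (Fin n))
    (τ τ' : Config G n) :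
    step G (τ ∘ e) (τ' ∘ e) = step G τ τ' := by
  unfold step
  congr 2
  refine Finset.card_equiv (moveEquiv e) fun m => ?_
  simp only [Finset.mem_filter, Finset.mem_univ, true_and, applyMove_comp_perm,
    e.surjective.injective_comp_right.eq_iff]

theorem law_comp_perm (G : Type) [Group G] [Fintype G] {n : ℕ} (e : Equiv.Perm (Fin n))
    (σ₀ : Config G n) (he : σ₀ ∘ e = σ₀) (t : ℕ) (τ : Config G n) : law G σ₀ t (τ ∘ e) = law G σ₀ t τ := by
  induction t generalizing τ with
  | zero =>
    have h : τ ∘ e = σ₀ ↔ τ = σ₀ := by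
      conv_lhs => rw [← he]
      exact e.surjective.injective_comp_right.eq_iff
    simp only [law, h]
  | succ t ih =>
    simp only [law]
    refine (Fintype.sum_equiv (Equiv.arrowCongr e.symm (Equiv.refl G)) _ _ fun ρ => ?_).symm
    have h : Equiv.arrowCongr e.symm (Equiv.refl G) ρ = ρ ∘ e := rfl
    rw [h, ih, step_comp_perm]

theorem statDist_comp_perm (G : Type) [Group G] [Fintype G] {n : ℕ} (e : Equiv.Perm (Fin n))
    (τ : Config G n) :
    statDist G n (τ ∘ e) = statDist G n τ := by
  have h : τ ∘ e ∈ gens G n ↔ τ ∈ gens G n := by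
    simp only [gens, Set.mem_ofPred_eq, e.surjective.range_comp]
  simp only [statDist, h]

/-- Configurations with the same proportion matrix relative to `σ₀` differ by a permutation of
the sites that fixes `σ₀`. -/
theorem exists_perm_of_nab_eq (G : Type) {n : ℕ} (σ₀ τ τ' : Config G n)
    (h : nab G σ₀ τ = nab G σ₀ τ') :
    ∃ e : Equiv.Perm (Fin n), σ₀ ∘ e = σ₀ ∧ τ' ∘ e = τ := by
  have hc (c : G × G) : Nonempty ({i // (σ₀ i, τ i) = c} ≃ {i // (σ₀ i, τ' i) = c}) := by
    refine ⟨Fintype.equivOfCardEq ?_⟩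
    have := congrFun (congrFun h c.1) c.2
    simpa only [nab, Fintype.card_subtype, Prod.ext_iff] using this
  let e : Equiv.Perm (Fin n) := Equiv.ofFiberEquiv fun c => (hc c).some
  have he (i : Fin n) : (σ₀ (e i), τ' (e i)) = (σ₀ i, τ i) :=
    Equiv.ofFiberEquiv_map (fun c => (hc c).some) i
  exact ⟨e, funext fun i => (Prod.ext_iff.mp (he i)).1, funext fun i => (Prod.ext_iff.mp (he i)).2⟩

end PR

/-- Lemma 2.3: for any starting configuration `σ_* ∈ S` and any `t ≥ 0`,
the total-variation distance of the law of `σ_t` from `π` equals the total-variation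
distance of the law of the proportion matrix `(n^{σ_*}_{a,b}(σ_t))_{a,b}` from its
stationary measure `π̄^{σ_*}` (the pushforward of `π`). -/
theorem matrix_chain_tv_eq
    (G : Type) [Group G] [Fintype G] (n : ℕ) (σast : PR.Config G n)
    (hσ : σast ∈ PR.gens G n) (t : ℕ) :
    PR.tvDist (PR.law G σast t) (PR.statDist G n)
      = PR.tvDist (PR.matPush G σast (PR.law G σast t))
          (PR.matPush G σast (PR.statDist G n)) := by
  refine (PR.tvDist_eq_tvDist_push (PR.nab G σast) _ _ (fun τ τ' h => ?_)
    fun τ τ' h => ?_).trans ?_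
  · obtain ⟨e, he, rfl⟩ := PR.exists_perm_of_nab_eq G σast τ τ' h
    exact PR.law_comp_perm G e σast he t τ'
  · obtain ⟨e, -, rfl⟩ := PR.exists_perm_of_nab_eq G σast τ τ' h
    exact PR.statDist_comp_perm G e τ'
  · congr 1 <;> funext N <;> exact Finset.sum_congr
      (by ext τ; simp only [Finset.mem_filter, funext_iff]) fun _ _ => rfl
end
end
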